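/- Let T be a Calderón–Zygmund operator with normalised standard kernel of Hölder exponent γ, s ∈ ℕ, and let K, L ∈ 𝒟 with K = L∔m for some m ∈ ℤⁿ, and ζ ∈ {0,1}ⁿ∖{0}. Then, with C depending only on n, γ: 2^{−ns/2} |⟨h⁰_{K^{(s)}}, T_{4·2^s ℓ(L)} h^ζ_L⟩| ≤ C [ |m|^{−n−γ} · 1{|m| > 2·2^s} + 2^{−s(n+1)} · 1{ | |m| − 4·2^s | < 1 + 2^s } ]. -/

import Mathlib

open MeasureTheory

noncomputable section

open Classical in
/-- Classical indicator of a proposition. -/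
def indR (P : Prop) : ℝ := if P then 1 else 0

/-- The real sign associated to a boolean. -/
def sgnB (b : Bool) : ℝ := if b then 1 else -1

/-- The `ℓ∞` norm of an integer vector, as a real number. -/
def inorm {n : ℕ} (m : Fin n → ℤ) : ℝ := ‖(fun i => (m i : ℝ) : Fin n → ℝ)‖

/-- The dyadic cube `2^{-k}([0,1)^n + m)` of generation `k` in `ℝ^n` (with the `ℓ∞` metric). -/
def dyadicCube (n : ℕ) (k : ℤ) (m : Fin n → ℤ) : Set (Fin n → ℝ) :=
  {x | ∀ i, (2:ℝ) ^ (-k) * m i ≤ x i ∧ x i < (2:ℝ) ^ (-k) * (m i + 1)}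

/-- The side length `2^{-k}` of a dyadic cube of generation `k`. -/
def sideLen (k : ℤ) : ℝ := (2:ℝ) ^ (-k)

/-- One-dimensional Haar function on the dyadic interval `2^{-k}[m, m+1)`:
the non-cancellative `h⁰` for `η = false`, the cancellative `h¹` for `η = true`. -/
def haar1D (k : ℤ) (m : ℤ) (η : Bool) (t : ℝ) : ℝ :=
  (Real.sqrt ((2:ℝ) ^ (-k)))⁻¹ *
    (if η then
        (Set.Ico ((2:ℝ) ^ (-k) * m) ((2:ℝ) ^ (-k) * (m + 1/2))).indicator 1 t
          - (Set.Ico ((2:ℝ) ^ (-k) * (m + 1/2)) ((2:ℝ) ^ (-k) * (m + 1))).indicator 1 t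
      else (Set.Ico ((2:ℝ) ^ (-k) * m) ((2:ℝ) ^ (-k) * (m + 1))).indicator 1 t)

/-- The Haar function `h^η_I` for the dyadic cube `I` indexed by `(k, m)`. -/
def haarFn (n : ℕ) (k : ℤ) (m : Fin n → ℤ) (η : Fin n → Bool) (x : Fin n → ℝ) : ℝ :=
  ∏ i, haar1D k (m i) (η i) (x i)

/-- The non-cancellative Haar function `h⁰_I = |I|^{-1/2} 1_I`. -/
def haarZero (n : ℕ) (k : ℤ) (m : Fin n → ℤ) : (Fin n → ℝ) → ℝ :=
  haarFn n k m (fun _ => false)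

/-- The pairing `⟨g, f⟩ = ∫ g f dx`. -/
def pairing {n : ℕ} (g f : (Fin n → ℝ) → ℝ) : ℝ := ∫ x, g x * f x

/-- A normalised standard kernel with Hölder exponent `γ` (with respect to the `ℓ∞` metric). -/
structure IsNormalisedKernel (n : ℕ) (γ : ℝ) (K : (Fin n → ℝ) → (Fin n → ℝ) → ℝ) : Prop where
  size : ∀ x y, x ≠ y → |K x y| ≤ dist x y ^ (-(n:ℝ))
  smooth : ∀ x y h, 2 * ‖h‖ < dist x y →
    |K (x + h) y - K x y| + |K x (y + h) - K x y| ≤ ‖h‖ ^ γ * dist x y ^ (-(n:ℝ) - γ)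

/-- The singular integral `Tf(x) = ∫ K(x,y) f(y) dy`. -/
def czIntegral {n : ℕ} (K : (Fin n → ℝ) → (Fin n → ℝ) → ℝ) (f : (Fin n → ℝ) → ℝ)
    (x : Fin n → ℝ) : ℝ := ∫ y, K x y * f y

/-- The truncated singular integral `T_ε f(x) = ∫_{|y-x|>ε} K(x,y) f(y) dy`. -/
def czTrunc {n : ℕ} (K : (Fin n → ℝ) → (Fin n → ℝ) → ℝ) (ε : ℝ) (f : (Fin n → ℝ) → ℝ)
    (x : Fin n → ℝ) : ℝ := ∫ y in {y | ε < dist x y}, K x y * f y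

/-- The dyadic conditional expectation `E_k f`. -/
def dyadicE (n : ℕ) (k : ℤ) (f : (Fin n → ℝ) → ℝ) (x : Fin n → ℝ) : ℝ :=
  (2:ℝ) ^ (k * (n:ℤ)) * ∫ y in dyadicCube n k (fun i => ⌊(2:ℝ) ^ k * x i⌋), f y

/-- The dyadic martingale difference `D_k f = E_{k+1} f - E_k f`. -/
def dyadicD (n : ℕ) (k : ℤ) (f : (Fin n → ℝ) → ℝ) (x : Fin n → ℝ) : ℝ :=
  dyadicE n (k+1) f x - dyadicE n k f x

/-- The centre of the dyadic cube indexed by `(k, m)`. -/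
def cubeCenter (n : ℕ) (k : ℤ) (m : Fin n → ℤ) : Fin n → ℝ :=
  fun i => (2:ℝ) ^ (-k) * (m i + 1/2)

/-- The concentric `c`-fold expansion of the dyadic cube indexed by `(k, m)`. -/
def expandCube (n : ℕ) (k : ℤ) (m : Fin n → ℤ) (c : ℝ) : Set (Fin n → ℝ) :=
  {x | ∀ i, |x i - cubeCenter n k m i| ≤ c * (2:ℝ) ^ (-k) / 2}

/-- The set `Σ_{f,s} = ⋃_k 9Ω_k`, where `Ω_k` is the union of the cubes `I ∈ 𝒟_k` on which
`D_{k+s} f` is not a.e. zero. -/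
def SigmaSet (n : ℕ) (f : (Fin n → ℝ) → ℝ) (s : ℕ) : Set (Fin n → ℝ) :=
  ⋃ (k : ℤ) (m : Fin n → ℤ)
    (_ : ¬ (∀ᵐ x ∂(volume.restrict (dyadicCube n k m)), dyadicD n (k + (s:ℤ)) f x = 0)),
      expandCube n k m 9

/-- The (measure-theoretic) support of a measurable function: the complement of the union of
all balls on which the function vanishes a.e. -/
def suppAE {n : ℕ} (f : (Fin n → ℝ) → ℝ) : Set (Fin n → ℝ) :=
  {x | ∀ r > 0, ¬ (∀ᵐ y ∂(volume.restrict (Metric.ball x r)), f y = 0)}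

/-- The axis-parallel closed cube with centre `c` and side length `ρ`. -/
def cube (n : ℕ) (c : Fin n → ℝ) (ρ : ℝ) : Set (Fin n → ℝ) :=
  {x | ∀ i, |x i - c i| ≤ ρ / 2}

/-- The index of the `s`-th dyadic ancestor `I^{(s)}` of the cube indexed by `(k, m)`
(the ancestor is the cube indexed by `(k - s, ancestorIdx s m)`). -/
def ancestorIdx {n : ℕ} (s : ℕ) (m : Fin n → ℤ) : Fin n → ℤ :=
  fun i => Int.fdiv (m i) (2 ^ s)

/-- The distance between two sets (in the ambient metric). -/
def setDist {α : Type*} [PseudoMetricSpace α] (A B : Set α) : ℝ :=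
  sInf (Set.image2 dist A B)

/-! ### Dyadic cubes and Haar functions -/

lemma sideLen_pos (k : ℤ) : 0 < sideLen k := by unfold sideLen; positivity

lemma sideLen_sub_natCast (k : ℤ) (s : ℕ) : sideLen (k - s) = 2 ^ s * sideLen k := by
  unfold sideLen
  rw [show -(k - (s : ℤ)) = (s : ℤ) + -k by ring, zpow_add₀ (by norm_num), zpow_natCast]

lemma dyadicCube_eq_pi (n : ℕ) (k : ℤ) (m : Fin n → ℤ) :
    dyadicCube n k m =
      Set.univ.pi fun i => Set.Ico (sideLen k * m i) (sideLen k * (m i + 1)) := by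
  ext x
  simp [dyadicCube, sideLen]

lemma measurableSet_dyadicCube (n : ℕ) (k : ℤ) (m : Fin n → ℤ) :
    MeasurableSet (dyadicCube n k m) := by
  rw [dyadicCube_eq_pi]
  exact MeasurableSet.univ_pi fun _ => measurableSet_Ico

lemma volume_dyadicCube (n : ℕ) (k : ℤ) (m : Fin n → ℤ) :
    volume (dyadicCube n k m) = ENNReal.ofReal (sideLen k ^ n) := by
  rw [dyadicCube_eq_pi, Real.volume_pi_Ico, ENNReal.ofReal_pow (sideLen_pos k).le]
  simp [mul_add]

lemma volume_dyadicCube_ne_top (n : ℕ) (k : ℤ) (m : Fin n → ℤ) :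
    volume (dyadicCube n k m) ≠ ⊤ := by
  rw [volume_dyadicCube]; exact ENNReal.ofReal_ne_top

lemma volume_real_dyadicCube (n : ℕ) (k : ℤ) (m : Fin n → ℤ) :
    volume.real (dyadicCube n k m) = sideLen k ^ n := by
  rw [measureReal_def, volume_dyadicCube, ENNReal.toReal_ofReal (pow_pos (sideLen_pos k) n).le]

lemma abs_haar1D_le (k m : ℤ) (η : Bool) (t : ℝ) :
    |haar1D k m η t| ≤ (√(sideLen k))⁻¹ := by
  unfold haar1D sideLen
  rw [abs_mul, abs_of_nonneg (by positivity)]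
  refine mul_le_of_le_one_right (by positivity) ?_
  split_ifs with h
  · simp only [Set.indicator_apply, Set.mem_Ico, Pi.one_apply]
    split_ifs with h1 h2 h2
    · linarith [h1.2, h2.1]
    all_goals norm_num
  · simp only [Set.indicator_apply, Pi.one_apply]
    split_ifs <;> norm_num

lemma haar1D_eq_zero (k m : ℤ) (η : Bool) (t : ℝ)
    (ht : t ∉ Set.Ico (sideLen k * m) (sideLen k * (m + 1))) : haar1D k m η t = 0 := by
  have hl := sideLen_pos k
  unfold haar1D
  change _ * (if η = true then
        (Set.Ico (sideLen k * m) (sideLen k * (m + 1/2))).indicator 1 t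
          - (Set.Ico (sideLen k * (m + 1/2)) (sideLen k * (m + 1))).indicator 1 t
      else (Set.Ico (sideLen k * m) (sideLen k * (m + 1))).indicator 1 t) = 0
  rw [Set.indicator_of_notMem ht, Set.indicator_of_notMem, Set.indicator_of_notMem]
  · simp
  · exact fun h => ht ⟨by nlinarith [h.1], h.2⟩
  · exact fun h => ht ⟨h.1, by nlinarith [h.2]⟩

lemma abs_haarFn_le (n : ℕ) (k : ℤ) (m : Fin n → ℤ) (η : Fin n → Bool) (x : Fin n → ℝ) :
    |haarFn n k m η x| ≤ (dyadicCube n k m).indicator (fun _ => (√(sideLen k))⁻¹ ^ n) x := by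
  by_cases hx : x ∈ dyadicCube n k m
  · rw [Set.indicator_of_mem hx, haarFn, Finset.abs_prod]
    calc ∏ i, |haar1D k (m i) (η i) (x i)| ≤ ∏ _i : Fin n, (√(sideLen k))⁻¹ :=
          Finset.prod_le_prod (fun _ _ => abs_nonneg _) fun i _ => abs_haar1D_le ..
      _ = _ := by simp
  · rw [Set.indicator_of_notMem hx, abs_nonpos_iff]
    rw [dyadicCube_eq_pi, Set.mem_univ_pi, not_forall] at hx
    obtain ⟨i, hi⟩ := hx
    exact Finset.prod_eq_zero (Finset.mem_univ i) (haar1D_eq_zero _ _ _ _ hi)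

lemma haarFn_eq_zero {n : ℕ} {k : ℤ} {m : Fin n → ℤ} (η : Fin n → Bool) {x : Fin n → ℝ}
    (hx : x ∉ dyadicCube n k m) : haarFn n k m η x = 0 := by
  simpa [hx] using abs_haarFn_le n k m η x

lemma integrable_indicator_Ico (a b : ℝ) : Integrable ((Set.Ico a b).indicator (1 : ℝ → ℝ)) :=
  (integrable_indicator_iff measurableSet_Ico).2 (integrableOn_const (by simp))

lemma integrable_haar1D (k m : ℤ) (η : Bool) : Integrable (haar1D k m η) := by
  unfold haar1D
  refine Integrable.const_mul ?_ _
  split_ifs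
  · exact (integrable_indicator_Ico _ _).sub (integrable_indicator_Ico _ _)
  · exact integrable_indicator_Ico _ _

lemma integral_haar1D_true (k m : ℤ) : ∫ t, haar1D k m true t = 0 := by
  have hl := sideLen_pos k
  unfold sideLen at hl
  unfold haar1D
  simp only [if_true]
  rw [integral_const_mul, integral_sub (integrable_indicator_Ico _ _)
    (integrable_indicator_Ico _ _), integral_indicator_one measurableSet_Ico,
    integral_indicator_one measurableSet_Ico, Real.volume_real_Ico_of_le (by nlinarith),
    Real.volume_real_Ico_of_le (by nlinarith)]
  ring

lemma integrable_haarFn (n : ℕ) (k : ℤ) (m : Fin n → ℤ) (η : Fin n → Bool) :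
    Integrable (haarFn n k m η) :=
  Integrable.fintype_prod (f := fun i => haar1D k (m i) (η i)) fun _ => integrable_haar1D ..

lemma integral_haarFn_eq_zero {n : ℕ} (k : ℤ) (m : Fin n → ℤ) {η : Fin n → Bool}
    (hη : η ≠ fun _ => false) : ∫ x, haarFn n k m η x = 0 := by
  obtain ⟨i, hi⟩ := Function.ne_iff.1 hη
  simp only [ne_eq, Bool.not_eq_false] at hi
  unfold haarFn
  rw [integral_fintype_prod_volume_eq_prod fun i => haar1D k (m i) (η i)]
  refine Finset.prod_eq_zero (Finset.mem_univ i) ?_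
  rw [hi, integral_haar1D_true]

/-! ### Geometry of the cubes -/

lemma mem_Ico_ancestor (s : ℕ) (k M : ℤ) {t : ℝ}
    (ht : t ∈ Set.Ico (sideLen k * M) (sideLen k * (M + 1))) :
    t ∈ Set.Ico (sideLen (k - s) * (M.fdiv (2 ^ s) : ℤ))
      (sideLen (k - s) * ((M.fdiv (2 ^ s) : ℤ) + 1)) := by
  have hl := sideLen_pos k
  have h1 : (2 ^ s : ℤ) * M.fdiv (2 ^ s) ≤ M := Int.mul_fdiv_self_le (by positivity)
  have h2 : M + 1 ≤ (M.fdiv (2 ^ s) + 1) * (2 ^ s : ℤ) :=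
    Int.lt_fdiv_add_one_mul_self M (by positivity)
  have h1' : (2 ^ s : ℝ) * (M.fdiv (2 ^ s) : ℤ) ≤ M := by exact_mod_cast h1
  have h2' : (M : ℝ) + 1 ≤ ((M.fdiv (2 ^ s) : ℤ) + 1) * (2 ^ s : ℝ) := by exact_mod_cast h2
  rw [sideLen_sub_natCast]
  constructor
  · nlinarith [ht.1]
  · nlinarith [ht.2]

lemma abs_dist_sub_inorm_lt {n : ℕ} {s : ℕ} {k : ℤ} {mL m : Fin n → ℤ} {x y : Fin n → ℝ}
    (hx : x ∈ dyadicCube n (k - s) (ancestorIdx s (mL + m))) (hy : y ∈ dyadicCube n k mL) :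
    |dist x y - sideLen k * inorm m| < 2 ^ s * sideLen k := by
  have hl := sideLen_pos k
  rw [dyadicCube_eq_pi, Set.mem_univ_pi] at hx hy
  have key : ‖(x - y) - sideLen k • (fun i => (m i : ℝ))‖ < 2 ^ s * sideLen k := by
    rw [pi_norm_lt_iff (by positivity)]
    intro i
    have h := mem_Ico_ancestor s k (mL i + m i) (t := y i + sideLen k * m i)
      (by push_cast; constructor <;> nlinarith [(hy i).1, (hy i).2])
    have hxi := hx i
    simp only [ancestorIdx, Pi.add_apply] at hxi
    have e : sideLen (k - s) * (((mL i + m i).fdiv (2 ^ s) : ℤ) + 1 : ℝ) =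
      sideLen (k - s) * ((mL i + m i).fdiv (2 ^ s) : ℤ) + 2 ^ s * sideLen k := by
      rw [mul_add, mul_one, ← sideLen_sub_natCast]
    rw [Set.mem_Ico, e] at h hxi
    simp only [Pi.sub_apply, Pi.smul_apply, smul_eq_mul, Real.norm_eq_abs]
    rw [abs_lt]
    constructor <;> linarith [h.1, h.2, hxi.1, hxi.2]
  refine lt_of_le_of_lt ?_ key
  refine le_trans (le_of_eq ?_) (abs_norm_sub_norm_le _ _)
  rw [norm_smul, Real.norm_of_nonneg hl.le, dist_eq_norm, inorm]

lemma cubeCenter_mem (n : ℕ) (k : ℤ) (m : Fin n → ℤ) :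
    cubeCenter n k m ∈ dyadicCube n k m := by
  intro i
  have hl : (0 : ℝ) < 2 ^ (-k) := by positivity
  simp only [cubeCenter]
  constructor <;> nlinarith

lemma dist_cubeCenter_le {n : ℕ} {k : ℤ} {m : Fin n → ℤ} {y : Fin n → ℝ}
    (hy : y ∈ dyadicCube n k m) : dist y (cubeCenter n k m) ≤ sideLen k / 2 := by
  have hl := sideLen_pos k
  rw [dist_pi_le_iff (by positivity)]
  intro i
  have h := hy i
  simp only [cubeCenter, sideLen] at *
  rw [Real.dist_eq, abs_le]
  constructor <;> nlinarith [h.1, h.2]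

/-- The closed annulus between the `ℓ∞` balls of radii `r` and `R`. -/
def shell {n : ℕ} (c : Fin n → ℝ) (r R : ℝ) : Set (Fin n → ℝ) :=
  Metric.closedBall c R \ Metric.ball c r

lemma measurableSet_shell {n : ℕ} (c : Fin n → ℝ) (r R : ℝ) : MeasurableSet (shell c r R) :=
  Metric.isClosed_closedBall.measurableSet.diff Metric.isOpen_ball.measurableSet

lemma volume_shell_ne_top {n : ℕ} (c : Fin n → ℝ) (r R : ℝ) : volume (shell c r R) ≠ ⊤ :=
  ne_top_of_le_ne_top measure_closedBall_lt_top.ne (measure_mono Set.sdiff_subset)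

lemma volume_real_shell_le {n : ℕ} (c : Fin n → ℝ) {r R : ℝ} (hr : 0 < r) (hrR : r ≤ R) :
    volume.real (shell c r R) ≤ 2 ^ n * ((R - r) * n * R ^ (n - 1)) := by
  have hR : 0 < R := hr.trans_le hrR
  rw [shell, measureReal_sdiff (Metric.ball_subset_closedBall.trans
    (Metric.closedBall_subset_closedBall hrR)) Metric.isOpen_ball.measurableSet
    measure_closedBall_lt_top.ne, measureReal_def, measureReal_def, Real.volume_pi_closedBall _ hR.le,
    Real.volume_pi_ball _ hr, ENNReal.toReal_ofReal (by positivity),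
    ENNReal.toReal_ofReal (by positivity), Fintype.card_fin, mul_pow, mul_pow, ← mul_sub]
  gcongr
  have := abs_pow_sub_pow_le R r n
  rw [abs_of_nonneg (sub_nonneg.2 hrR), abs_of_pos hR, abs_of_pos hr, max_eq_left hrR] at this
  exact (le_abs_self _).trans this

/-! ### Kernel estimates -/

lemma indR_nonneg (P : Prop) : 0 ≤ indR P := by unfold indR; split_ifs <;> norm_num

lemma indR_of_true {P : Prop} (h : P) : indR P = 1 := if_pos h

lemma integral_indicator_dyadicCube (n : ℕ) (k : ℤ) (m : Fin n → ℤ) (c : ℝ) :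
    ∫ x, (dyadicCube n k m).indicator (fun _ => c) x = sideLen k ^ n * c := by
  rw [integral_indicator_const _ (measurableSet_dyadicCube ..), volume_real_dyadicCube,
    smul_eq_mul]

lemma integrable_indicator_dyadicCube (n : ℕ) (k : ℤ) (m : Fin n → ℤ) (c : ℝ) :
    Integrable ((dyadicCube n k m).indicator fun _ => c) :=
  (integrable_indicator_iff (measurableSet_dyadicCube ..)).2
    (integrableOn_const (volume_dyadicCube_ne_top n k m))

lemma measurableSet_lt_dist {n : ℕ} (ε : ℝ) (x : Fin n → ℝ) :
    MeasurableSet {y | ε < dist x y} :=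
  (isOpen_lt continuous_const (continuous_const.dist continuous_id)).measurableSet

/-- The truncated integral acting on a Haar function, bounded using only the size of the kernel. -/
lemma abs_czTrunc_haarFn_le_of_size {n : ℕ} {γ : ℝ} {K : (Fin n → ℝ) → (Fin n → ℝ) → ℝ}
    (hK : IsNormalisedKernel n γ K) {ε : ℝ} (hε : 0 < ε) (k : ℤ) (mL : Fin n → ℤ)
    (ζ : Fin n → Bool) (x : Fin n → ℝ) :
    |czTrunc K ε (haarFn n k mL ζ) x| ≤
      sideLen k ^ n * (ε ^ (-(n : ℝ)) * (√(sideLen k))⁻¹ ^ n) := by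
  rw [czTrunc, ← integral_indicator (measurableSet_lt_dist ε x), ← Real.norm_eq_abs,
    ← integral_indicator_dyadicCube n k mL]
  refine norm_integral_le_of_norm_le (integrable_indicator_dyadicCube ..)
    (Filter.Eventually.of_forall fun y => ?_)
  have h0 : 0 ≤ ε ^ (-(n : ℝ)) := by positivity
  have hh := abs_haarFn_le n k mL ζ y
  by_cases hy : y ∈ dyadicCube n k mL
  · rw [Set.indicator_of_mem hy] at hh ⊢
    by_cases hd : ε < dist x y
    · rw [Set.indicator_of_mem (s := {y | ε < dist x y}) hd, Real.norm_eq_abs, abs_mul]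
      refine mul_le_mul ?_ hh (abs_nonneg _) h0
      refine (hK.size x y (dist_pos.1 (hε.trans hd))).trans ?_
      exact Real.rpow_le_rpow_of_nonpos hε hd.le (by simp)
    · rw [Set.indicator_of_notMem (s := {y | ε < dist x y}) hd, norm_zero]
      positivity
  · rw [Set.indicator_of_notMem hy] at hh ⊢
    rw [abs_nonpos_iff] at hh
    simp [Set.indicator_apply, hh]

/-- The truncated integral acting on a Haar function whose cube is not cut by the truncation. -/
lemma abs_czTrunc_haarFn_le_of_smooth {n : ℕ} {γ : ℝ} (hγ : 0 < γ)
    {K : (Fin n → ℝ) → (Fin n → ℝ) → ℝ}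
    (hK : IsNormalisedKernel n γ K) {ε : ℝ} {k : ℤ} {mL : Fin n → ℤ} (hε : sideLen k ≤ ε)
    {ζ : Fin n → Bool} (hζ : ζ ≠ fun _ => false) {x : Fin n → ℝ}
    (hx : ∀ y ∈ dyadicCube n k mL, ε < dist x y) :
    |czTrunc K ε (haarFn n k mL ζ) x| ≤
      sideLen k ^ n * (sideLen k ^ γ * dist x (cubeCenter n k mL) ^ (-(n : ℝ) - γ) *
        (√(sideLen k))⁻¹ ^ n) := by
  have hl := sideLen_pos k
  set c := cubeCenter n k mL with hc
  have hcd : ε < dist x c := hx c (cubeCenter_mem n k mL)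
  have e : czTrunc K ε (haarFn n k mL ζ) x = ∫ y, K x y * haarFn n k mL ζ y := by
    refine setIntegral_eq_integral_of_forall_compl_eq_zero fun y hy => ?_
    rw [haarFn_eq_zero ζ fun h => hy (hx y h), mul_zero]
  rw [e]
  by_cases hi : Integrable fun y => K x y * haarFn n k mL ζ y
  swap
  · rw [integral_undef hi, abs_zero]; positivity
  have e2 : ∫ y, K x y * haarFn n k mL ζ y = ∫ y, (K x y - K x c) * haarFn n k mL ζ y := by
    simp only [sub_mul]
    rw [integral_sub hi ((integrable_haarFn ..).const_mul _), integral_const_mul,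
      integral_haarFn_eq_zero k mL hζ, mul_zero, sub_zero]
  rw [e2, ← Real.norm_eq_abs, ← integral_indicator_dyadicCube n k mL]
  refine norm_integral_le_of_norm_le (integrable_indicator_dyadicCube ..)
    (Filter.Eventually.of_forall fun y => ?_)
  have hh := abs_haarFn_le n k mL ζ y
  by_cases hy : y ∈ dyadicCube n k mL
  · rw [Set.indicator_of_mem hy] at hh ⊢
    rw [Real.norm_eq_abs, abs_mul]
    refine mul_le_mul ?_ hh (abs_nonneg _) (by positivity)
    have hn : ‖y - c‖ ≤ sideLen k / 2 := by rw [← dist_eq_norm]; exact dist_cubeCenter_le hy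
    have := hK.smooth x c (y - c) (by linarith)
    rw [add_sub_cancel] at this
    refine (le_add_of_nonneg_left (abs_nonneg _)).trans (this.trans ?_)
    gcongr
    linarith
  · rw [Set.indicator_of_notMem hy] at hh ⊢
    rw [abs_nonpos_iff] at hh
    simp [hh]

lemma abs_czTrunc_haarFn_le {n : ℕ} {γ : ℝ} (hγ : 0 < γ)
    {K : (Fin n → ℝ) → (Fin n → ℝ) → ℝ} (hK : IsNormalisedKernel n γ K)
    (s : ℕ) (k : ℤ) (mL m : Fin n → ℤ) {ζ : Fin n → Bool} (hζ : ζ ≠ fun _ => false)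
    {x : Fin n → ℝ} (hx : x ∈ dyadicCube n (k - s) (ancestorIdx s (mL + m))) :
    |czTrunc K (4 * 2 ^ s * sideLen k) (haarFn n k mL ζ) x| ≤
      (√(sideLen k))⁻¹ ^ n *
        (indR (2 * 2 ^ s < inorm m) * (2 ^ ((n : ℝ) + γ) * inorm m ^ (-(n : ℝ) - γ)) +
        indR (|inorm m - 4 * 2 ^ s| < 1 + 2 ^ s) * (4 * 2 ^ s)⁻¹ ^ n *
          (shell (cubeCenter n k mL) ((4 * 2 ^ s - 1) * sideLen k)
            ((4 * 2 ^ s + 1) * sideLen k)).indicator 1 x) := by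
  have hl := sideLen_pos k
  have hR : (1 : ℝ) ≤ 2 ^ s := one_le_pow₀ (by norm_num)
  have hRl : sideLen k ≤ 2 ^ s * sideLen k := by nlinarith
  set ε : ℝ := 4 * 2 ^ s * sideLen k with hε
  have hε0 : 0 < ε := by positivity
  set c := cubeCenter n k mL with hc
  have hm0 : 0 ≤ inorm m := norm_nonneg _
  have hA : 0 ≤ indR (2 * 2 ^ s < inorm m) *
      (2 ^ ((n : ℝ) + γ) * inorm m ^ (-(n : ℝ) - γ)) := by
    have := indR_nonneg (2 * 2 ^ s < inorm m); positivity
  have hB : 0 ≤ indR (|inorm m - 4 * 2 ^ s| < 1 + 2 ^ s) * (4 * 2 ^ s)⁻¹ ^ n *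
      (shell c ((4 * 2 ^ s - 1) * sideLen k)
        ((4 * 2 ^ s + 1) * sideLen k)).indicator 1 x := by
    have := indR_nonneg (|inorm m - 4 * 2 ^ s| < 1 + 2 ^ s)
    have h2 : 0 ≤ (shell c ((4 * 2 ^ s - 1) * sideLen k)
        ((4 * 2 ^ s + 1) * sideLen k)).indicator (1 : (Fin n → ℝ) → ℝ) x :=
      Set.indicator_nonneg (fun _ _ => zero_le_one) _
    positivity
  by_cases hall : ∀ y ∈ dyadicCube n k mL, ε < dist x y
  · refine (abs_czTrunc_haarFn_le_of_smooth hγ hK (by linarith) hζ hall).trans ?_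
    have hcm : c ∈ dyadicCube n k mL := cubeCenter_mem n k mL
    have hcd := hall c hcm
    have hg := abs_lt.1 (abs_dist_sub_inorm_lt hx hcm)
    have hm : 2 * 2 ^ s < inorm m := by
      by_contra hcon
      have : sideLen k * inorm m ≤ sideLen k * (2 * 2 ^ s) := by gcongr; exact not_lt.1 hcon
      linarith [hg.2]
    have hmp : 0 < inorm m := by linarith
    have hd : sideLen k * inorm m / 2 ≤ dist x c := by
      have : sideLen k * (2 * 2 ^ s) < sideLen k * inorm m := by gcongr
      linarith [hg.1]
    have hp : dist x c ^ (-(n : ℝ) - γ) ≤ (sideLen k * inorm m / 2) ^ (-(n : ℝ) - γ) :=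
      Real.rpow_le_rpow_of_nonpos (by positivity) hd
        (by have : (0 : ℝ) ≤ n := n.cast_nonneg
            linarith)
    have he : sideLen k ^ n * (sideLen k ^ γ * (sideLen k * inorm m / 2) ^ (-(n : ℝ) - γ)) =
        2 ^ ((n : ℝ) + γ) * inorm m ^ (-(n : ℝ) - γ) := by
      have h2 : ((2 : ℝ)⁻¹) ^ (-(n : ℝ) - γ) = 2 ^ ((n : ℝ) + γ) := by
        rw [Real.inv_rpow (by norm_num), ← Real.rpow_neg (by norm_num)]; ring_nf
      have h3 : sideLen k ^ n * sideLen k ^ γ * sideLen k ^ (-(n : ℝ) - γ) = 1 := by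
        rw [← Real.rpow_natCast, ← Real.rpow_add hl, ← Real.rpow_add hl]
        ring_nf
        exact Real.rpow_zero _
      rw [div_eq_mul_inv, Real.mul_rpow (by positivity) (by positivity),
        Real.mul_rpow hl.le hm0, h2]
      linear_combination (inorm m ^ (-(n : ℝ) - γ) * 2 ^ ((n : ℝ) + γ)) * h3
    rw [indR_of_true hm] at hA ⊢
    calc _ ≤ sideLen k ^ n * (sideLen k ^ γ * (sideLen k * inorm m / 2) ^ (-(n : ℝ) - γ) *
            (√(sideLen k))⁻¹ ^ n) := by gcongr
      _ = (√(sideLen k))⁻¹ ^ n * (1 * (2 ^ ((n : ℝ) + γ) * inorm m ^ (-(n : ℝ) - γ))) := by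
          rw [← he]; ring
      _ ≤ _ := by gcongr; exact le_add_of_nonneg_right hB
  by_cases hex : ∃ y ∈ dyadicCube n k mL, ε < dist x y
  · push Not at hall
    obtain ⟨y', hy', hd'⟩ := hall
    obtain ⟨y, hy, hd⟩ := hex
    have hg := abs_lt.1 (abs_dist_sub_inorm_lt hx hy)
    have hg' := abs_lt.1 (abs_dist_sub_inorm_lt hx hy')
    have hm : |inorm m - 4 * 2 ^ s| < 1 + 2 ^ s := by
      have h1 : sideLen k * (3 * 2 ^ s) < sideLen k * inorm m := by linarith [hg.2]
      have h2 : sideLen k * inorm m < sideLen k * (5 * 2 ^ s) := by linarith [hg'.1]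
      have h1 := lt_of_mul_lt_mul_left h1 hl.le
      have h2 := lt_of_mul_lt_mul_left h2 hl.le
      rw [abs_lt]; constructor <;> linarith
    have hs : x ∈ shell c ((4 * 2 ^ s - 1) * sideLen k) ((4 * 2 ^ s + 1) * sideLen k) := by
      have h1 := dist_cubeCenter_le hy
      have h2 := dist_cubeCenter_le hy'
      have h3 := dist_triangle_right x y c
      have h4 := dist_triangle x y' c
      constructor
      · rw [Metric.mem_closedBall]; linarith
      · rw [Metric.mem_ball, not_lt]; linarith
    refine (abs_czTrunc_haarFn_le_of_size hK hε0 k mL ζ x).trans ?_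
    rw [indR_of_true hm, Set.indicator_of_mem hs, Pi.one_apply] at hB ⊢
    calc _ = (√(sideLen k))⁻¹ ^ n * (1 * (4 * 2 ^ s)⁻¹ ^ n * 1) := by
          rw [Real.rpow_neg hε0.le, Real.rpow_natCast, hε, mul_pow (4 * 2 ^ s : ℝ),
            inv_pow (4 * 2 ^ s : ℝ)]
          field_simp
      _ ≤ _ := by gcongr; exact le_add_of_nonneg_left hA
  · push Not at hex
    have : czTrunc K ε (haarFn n k mL ζ) x = 0 := by
      refine setIntegral_eq_zero_of_forall_eq_zero fun y hy => ?_
      rw [haarFn_eq_zero ζ fun h => (hex y h).not_gt hy, mul_zero]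
    rw [this, abs_zero]
    positivity

/-- Integrating the pointwise bound over the ancestor cube. -/
lemma abs_pairing_haarZero_le {n : ℕ} (k : ℤ) (M : Fin n → ℤ) {f : (Fin n → ℝ) → ℝ}
    {a b : ℝ} (hb : 0 ≤ b) {S : Set (Fin n → ℝ)} (hS : MeasurableSet S)
    (hS' : volume S ≠ ⊤)
    (hf : ∀ x ∈ dyadicCube n k M, |f x| ≤ a + b * S.indicator 1 x) :
    |pairing (haarZero n k M) f| ≤
      (√(sideLen k))⁻¹ ^ n * (sideLen k ^ n * a + b * volume.real S) := by
  have hSi : Integrable (S.indicator (1 : (Fin n → ℝ) → ℝ)) :=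
    (integrable_indicator_iff hS).2 (integrableOn_const hS')
  have e : (√(sideLen k))⁻¹ ^ n * (sideLen k ^ n * a + b * volume.real S) =
      ∫ x, (√(sideLen k))⁻¹ ^ n *
        ((dyadicCube n k M).indicator (fun _ => a) x + b * S.indicator 1 x) := by
    rw [integral_const_mul, integral_add (integrable_indicator_dyadicCube ..)
      (hSi.const_mul _), integral_const_mul, integral_indicator_one hS,
      integral_indicator_dyadicCube]
  rw [e, pairing, ← Real.norm_eq_abs]
  refine norm_integral_le_of_norm_le
    (((integrable_indicator_dyadicCube ..).add (hSi.const_mul _)).const_mul _)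
    (Filter.Eventually.of_forall fun x => ?_)
  have hh : |haarZero n k M x| ≤ _ := abs_haarFn_le n k M (fun _ => false) x
  rw [Real.norm_eq_abs, abs_mul]
  by_cases hx : x ∈ dyadicCube n k M
  · rw [Set.indicator_of_mem hx] at hh ⊢
    exact mul_le_mul hh (hf x hx) (abs_nonneg _) (by positivity)
  · rw [Set.indicator_of_notMem hx] at hh ⊢
    rw [abs_nonpos_iff.1 hh, abs_zero, zero_mul]
    have : 0 ≤ S.indicator (1 : (Fin n → ℝ) → ℝ) x :=
      Set.indicator_nonneg (fun _ _ => zero_le_one) _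
    positivity

/-- Lemma 5.5: bound for `2^{-ns/2} ⟨h⁰_{K^{(s)}}, T_{4·2^s ℓ(L)} h^ζ_L⟩` with `K = L∔m`. -/
theorem statement15 (n : ℕ) (hn : 0 < n) (γ : ℝ) (hγ0 : 0 < γ) (hγ1 : γ ≤ 1) :
    ∃ C : ℝ, 0 < C ∧
      ∀ K : (Fin n → ℝ) → (Fin n → ℝ) → ℝ, IsNormalisedKernel n γ K →
      ∀ (s : ℕ) (k : ℤ) (mL m : Fin n → ℤ) (ζ : Fin n → Bool), ζ ≠ (fun _ => false) →
        (2:ℝ) ^ (-((n:ℝ) * (s:ℝ)) / 2) *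
            |pairing (haarZero n (k - s) (ancestorIdx s (mL + m)))
              (czTrunc K (4 * 2^s * sideLen k) (haarFn n k mL ζ))| ≤
          C * (indR (2 * 2^s < inorm m) * inorm m ^ (-(n:ℝ) - γ) +
              indR (|inorm m - 4 * 2^s| < 1 + 2^s) *
                (2:ℝ) ^ (-(s:ℝ) * ((n:ℝ) + 1))) := by
  refine ⟨2 ^ ((n : ℝ) + γ) + 2 * n * 5 ^ n, by positivity, ?_⟩
  intro K hK s k mL m ζ hζ
  have hl := sideLen_pos k
  have hR : (1 : ℝ) ≤ 2 ^ s := one_le_pow₀ (by norm_num)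
  have hm0 : 0 ≤ inorm m := norm_nonneg _
  have hI := indR_nonneg (2 * 2 ^ s < inorm m)
  have hJ := indR_nonneg (|inorm m - 4 * 2 ^ s| < 1 + 2 ^ s)
  set I := indR (2 * 2 ^ s < inorm m) with hIdef
  set J := indR (|inorm m - 4 * 2 ^ s| < 1 + 2 ^ s) with hJdef
  set S := shell (cubeCenter n k mL) ((4 * 2 ^ s - 1) * sideLen k)
    ((4 * 2 ^ s + 1) * sideLen k) with hSdef
  set β := (√(sideLen k))⁻¹ ^ n with hβ
  set X := inorm m ^ (-(n : ℝ) - γ) with hX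
  have hX0 : 0 ≤ X := by positivity
  have hp := abs_pairing_haarZero_le (k - s) (ancestorIdx s (mL + m))
    (f := czTrunc K (4 * 2 ^ s * sideLen k) (haarFn n k mL ζ))
    (a := β * (I * (2 ^ ((n : ℝ) + γ) * X))) (b := β * (J * (4 * 2 ^ s)⁻¹ ^ n))
    (by positivity) (S := S) (measurableSet_shell ..) (volume_shell_ne_top _ _ _)
    (fun x hx => (abs_czTrunc_haarFn_le hγ0 hK s k mL m hζ hx).trans_eq (by ring))
  have hvol : volume.real S ≤
      2 ^ n * (2 * sideLen k * n * (5 * 2 ^ s * sideLen k) ^ (n - 1)) := by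
    refine (volume_real_shell_le _ (mul_pos (by linarith) hl)
      (by gcongr; linarith)).trans ?_
    gcongr
    · linarith
    · linarith
  have hpre : (2 : ℝ) ^ (-((n : ℝ) * (s : ℝ)) / 2) = (√(2 ^ s))⁻¹ ^ n := by
    rw [Real.sqrt_eq_rpow, ← Real.rpow_natCast 2 s, ← Real.rpow_mul (by norm_num),
      ← Real.rpow_neg (by norm_num), ← Real.rpow_natCast, ← Real.rpow_mul (by norm_num)]
    congr 1; ring
  have hlast : (2 : ℝ) ^ (-(s : ℝ) * ((n : ℝ) + 1)) = (2 ^ s)⁻¹ ^ (n + 1) := by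
    rw [← Real.rpow_natCast 2 s, ← Real.rpow_neg (by norm_num), ← Real.rpow_natCast,
      ← Real.rpow_mul (by norm_num)]
    push_cast; rfl
  have hnorm : (√(2 ^ s))⁻¹ ^ n * (√(sideLen (k - s)))⁻¹ ^ n * β =
      ((2 ^ s) * sideLen k)⁻¹ ^ n := by
    rw [hβ, ← mul_pow, ← mul_pow, sideLen_sub_natCast, Real.sqrt_mul (by positivity)]
    congr 1
    have h1 : √((2 : ℝ) ^ s) * √((2 : ℝ) ^ s) = 2 ^ s := Real.mul_self_sqrt (by positivity)
    have h2 : √(sideLen k) * √(sideLen k) = sideLen k := Real.mul_self_sqrt hl.le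
    rw [← mul_inv, ← mul_inv]
    congr 1
    linear_combination √(sideLen k) * √(sideLen k) * h1 + 2 ^ s * h2
  rw [hpre, hlast]
  have hnum : ((2 ^ s) * sideLen k)⁻¹ ^ n * ((4 * 2 ^ s)⁻¹ ^ n *
      (2 ^ n * (2 * sideLen k * n * (5 * 2 ^ s * sideLen k) ^ (n - 1)))) ≤
      2 * n * 5 ^ n * (2 ^ s : ℝ)⁻¹ ^ (n + 1) := by
    obtain ⟨d, rfl⟩ : ∃ d, n = d + 1 := ⟨n - 1, by omega⟩
    rw [Nat.add_sub_cancel]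
    have h42 : (4 : ℝ)⁻¹ ^ (d + 1) * 2 ^ (d + 1) ≤ 5 := by
      rw [← mul_pow]
      exact (pow_le_one₀ (by norm_num) (by norm_num)).trans (by norm_num)
    have e : ((2 ^ s) * sideLen k)⁻¹ ^ (d + 1) * ((4 * 2 ^ s)⁻¹ ^ (d + 1) *
      (2 ^ (d + 1) * (2 * sideLen k * (d + 1 : ℕ) * (5 * 2 ^ s * sideLen k) ^ d))) =
      ((4 : ℝ)⁻¹ ^ (d + 1) * 2 ^ (d + 1)) *
        (2 * (d + 1 : ℕ) * 5 ^ d * (2 ^ s : ℝ)⁻¹ ^ (d + 1 + 1)) := by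
      have hq : (2 : ℝ) ^ s ≠ 0 := by positivity
      generalize (2 : ℝ) ^ s = q at hq
      simp only [mul_inv, mul_pow, inv_pow]
      field_simp
      ring
    rw [e]
    calc _ ≤ 5 * (2 * (d + 1 : ℕ) * 5 ^ d * (2 ^ s : ℝ)⁻¹ ^ (d + 1 + 1)) := by gcongr
      _ = _ := by ring
  have hone : ((2 ^ s) * sideLen k)⁻¹ ^ n * sideLen (k - s) ^ n = 1 := by
    rw [sideLen_sub_natCast, ← mul_pow, inv_mul_cancel₀ (by positivity), one_pow]
  calc _ ≤ (√(2 ^ s))⁻¹ ^ n * ((√(sideLen (k - s)))⁻¹ ^ n *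
        (sideLen (k - s) ^ n * (β * (I * (2 ^ ((n : ℝ) + γ) * X))) +
          β * (J * (4 * 2 ^ s)⁻¹ ^ n) *
            (2 ^ n * (2 * sideLen k * n * (5 * 2 ^ s * sideLen k) ^ (n - 1))))) := by
        refine mul_le_mul_of_nonneg_left (hp.trans ?_) (by positivity)
        gcongr
    _ = (((2 ^ s) * sideLen k)⁻¹ ^ n * sideLen (k - s) ^ n) * (I * (2 ^ ((n : ℝ) + γ) * X)) +
        J * (((2 ^ s) * sideLen k)⁻¹ ^ n * ((4 * 2 ^ s)⁻¹ ^ n *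
          (2 ^ n * (2 * sideLen k * n * (5 * 2 ^ s * sideLen k) ^ (n - 1))))) := by
        rw [← hnorm]; ring
    _ ≤ 2 ^ ((n : ℝ) + γ) * (I * X) + 2 * n * 5 ^ n * (J * (2 ^ s : ℝ)⁻¹ ^ (n + 1)) := by
        rw [hone]
        refine add_le_add (by linarith) ?_
        exact (mul_le_mul_of_nonneg_left hnum hJ).trans_eq (by ring)
    _ ≤ _ := by
        have h1 : 0 ≤ 2 * n * 5 ^ n * (I * X) := by positivity
        have h2 : 0 ≤ 2 ^ ((n : ℝ) + γ) * (J * (2 ^ s : ℝ)⁻¹ ^ (n + 1)) := by positivity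
        linarith

end
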